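/- Distances to the pole of a mast: Let h ≥ 1 be an integer, let G be a simple graph containing three pairwise adjacent vertices u_1, u_2, u_3, and let G' be the graph obtained from G by attaching a mast of height h at (u_1, u_2, u_3). Let v_1 = x^1_h be the pole of the attached mast. Then dist_{G'}(u_1, v_1) = h, dist_{G'}(u_2, v_1) > h, and dist_{G'}(u_3, v_1) > h. -/

import Mathlib

/-!
The mast gadget `M h` has vertices `x^i_j` for `i ∈ {1,2,3}`, `0 ≤ j ≤ h`,
where `x^i_0 = u i` and the pole is `v 1 = x^1_h`.  The inner vertices (all
vertices except `u 1, u 2, u 3`) are encoded as `Fin 3 × Fin h`: the pair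
`(i, t)` stands for `x^{i+1}_{t+1}`.
-/

/-- Inner vertices of the mast gadget `M h`. -/
abbrev MastInner (h : ℕ) := Fin 3 × Fin h

/-- The graph obtained from `G` by attaching a mast `M h` at the three
pairwise adjacent vertices `u 0, u 1, u 2`.  Its edges are: the edges of `G`;
the attachment edges `{u i, x^i_1}` together with `{u 1, x^2_1}`,
`{u 1, x^3_1}`, `{u 2, x^3_1}` (i.e. `u i'` is joined to `x^i_1` whenever
`i' ≤ i`); the path edges `{x^i_j, x^i_{j+1}}`; the triangle edges
`{x^i_j, x^{i'}_j}` for `1 ≤ j ≤ h` and `i ≠ i'`; and the diagonal edges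
`{x^{i'}_{j-1}, x^i_j}` for `i' < i` and `2 ≤ j ≤ h` (the case `j = 1`
being an attachment edge). -/
def mastAttach {V : Type*} (G : SimpleGraph V) (h : ℕ) (u : Fin 3 → V) :
    SimpleGraph (V ⊕ MastInner h) :=
  SimpleGraph.fromRel fun a b =>
    match a, b with
    | Sum.inl a, Sum.inl b => G.Adj a b
    | Sum.inl a, Sum.inr (i, t) => t.val = 0 ∧ ∃ i' : Fin 3, i' ≤ i ∧ a = u i'
    | Sum.inr (i, t), Sum.inr (i', t') =>
        (i = i' ∧ t'.val = t.val + 1) ∨ (t = t' ∧ i ≠ i') ∨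
          (i < i' ∧ t'.val = t.val + 1)
    | _, _ => False

/-- A function growing by at most one along each edge bounds the extended distance from below. -/
theorem SimpleGraph.le_add_edist_of_adj {W : Type*} {H : SimpleGraph W} (f : W → ℕ)
    (hf : ∀ a b, H.Adj a b → f b ≤ f a + 1) (a b : W) :
    (f b : ℕ∞) ≤ f a + H.edist a b := by
  have key : ∀ {a b : W} (p : H.Walk a b), f b ≤ f a + p.length := by
    intro a b p
    induction p with
    | nil => simp
    | cons hadj p ih =>
      have := hf _ _ hadj
      rw [SimpleGraph.Walk.length_cons]
      omega
  by_cases hr : H.Reachable a b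
  · obtain ⟨p, hp⟩ := hr.exists_walk_length_eq_edist
    rw [← hp]
    exact_mod_cast key p
  · rw [SimpleGraph.edist_eq_top_of_not_reachable hr]
    simp

open Classical in
/-- A potential on the vertices of `mastAttach G h u`; for `v = u 0` it grows by at most one
along each edge. -/
noncomputable def mastPotential {V : Type*} (h : ℕ) (v : V) : V ⊕ MastInner h → ℕ
  | Sum.inl a => if a = v then 1 else 0
  | Sum.inr (i, t) => if i = 0 then t.val + 2 else t.val + 1

theorem mastPotential_le_add_one {V : Type*} (G : SimpleGraph V) (h : ℕ) (u : Fin 3 → V)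
    (a b : V ⊕ MastInner h) (hab : (mastAttach G h u).Adj a b) :
    mastPotential h (u 0) b ≤ mastPotential h (u 0) a + 1 := by
  rw [mastAttach, SimpleGraph.fromRel_adj] at hab
  obtain ⟨-, hab⟩ := hab
  rcases a with a | ⟨i, t⟩ <;> rcases b with b | ⟨j, s⟩ <;> simp only [mastPotential] at hab ⊢
  · split_ifs <;> omega
  · obtain ⟨hs, i', hi', rfl⟩ := hab.resolve_right id
    split_ifs with hj h0 <;> try omega
    subst hj
    exact absurd (congrArg u (Fin.le_zero_iff.mp hi')) h0
  · split_ifs <;> omega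
  · split_ifs <;> grind

theorem mastAttach_edist_le {V : Type*} (G : SimpleGraph V) (h : ℕ) (u : Fin 3 → V)
    (t : ℕ) (ht : t < h) :
    (mastAttach G h u).edist (Sum.inl (u 0)) (Sum.inr ((0 : Fin 3), ⟨t, ht⟩)) ≤
      (t + 1 : ℕ) := by
  induction t with
  | zero =>
    have hadj : (mastAttach G h u).Adj (Sum.inl (u 0)) (Sum.inr ((0 : Fin 3), ⟨0, ht⟩)) := by
      rw [mastAttach, SimpleGraph.fromRel_adj]
      exact ⟨Sum.inl_ne_inr, Or.inl ⟨rfl, 0, le_rfl, rfl⟩⟩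
    simpa using (SimpleGraph.edist_eq_one_iff_adj.mpr hadj).le
  | succ t ih =>
    have hadj : (mastAttach G h u).Adj (Sum.inr ((0 : Fin 3), ⟨t, by omega⟩))
        (Sum.inr ((0 : Fin 3), ⟨t + 1, ht⟩)) := by
      rw [mastAttach, SimpleGraph.fromRel_adj]
      exact ⟨by simp, Or.inl (Or.inl ⟨rfl, rfl⟩)⟩
    refine (SimpleGraph.edist_triangle
      (v := Sum.inr ((0 : Fin 3), ⟨t, by omega⟩))).trans ?_
    rw [SimpleGraph.edist_eq_one_iff_adj.mpr hadj, Nat.cast_succ (t + 1)]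
    gcongr
    exact ih _

/-- **Distances to the pole of a mast.**  If `G'` is obtained from `G` by
attaching a mast of height `h ≥ 1` at three pairwise adjacent vertices
`u 0, u 1, u 2` of `G`, and `v₁ = x^1_h` is the pole of the mast (encoded as
`Sum.inr (0, ⟨h-1, _⟩)`), then `dist_{G'}(u 0, v₁) = h` while
`dist_{G'}(u 1, v₁) > h` and `dist_{G'}(u 2, v₁) > h`. -/
theorem mastAttach_pole_edist {V : Type*} (G : SimpleGraph V) (h : ℕ) (hh : 1 ≤ h)
    (u : Fin 3 → V) (hadj : ∀ i j : Fin 3, i ≠ j → G.Adj (u i) (u j)) :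
    (mastAttach G h u).edist (Sum.inl (u 0))
        (Sum.inr ((0 : Fin 3), ⟨h - 1, by omega⟩)) = (h : ℕ∞) ∧
    (h : ℕ∞) < (mastAttach G h u).edist (Sum.inl (u 1))
        (Sum.inr ((0 : Fin 3), ⟨h - 1, by omega⟩)) ∧
    (h : ℕ∞) < (mastAttach G h u).edist (Sum.inl (u 2))
        (Sum.inr ((0 : Fin 3), ⟨h - 1, by omega⟩)) := by
  have lower := fun a => SimpleGraph.le_add_edist_of_adj (H := mastAttach G h u)
    (mastPotential h (u 0)) (mastPotential_le_add_one G h u) (Sum.inl a)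
    (Sum.inr ((0 : Fin 3), ⟨h - 1, by omega⟩))
  have pole : mastPotential h (u 0) (Sum.inr ((0 : Fin 3), ⟨h - 1, by omega⟩)) = h + 1 := by
    simp only [mastPotential, if_true]
    omega
  have far : ∀ i : Fin 3, i ≠ 0 → (h : ℕ∞) < (mastAttach G h u).edist (Sum.inl (u i))
      (Sum.inr ((0 : Fin 3), ⟨h - 1, by omega⟩)) := by
    intro i hi
    have hl := lower (u i)
    have h0 : mastPotential h (u 0) (Sum.inl (u i)) = 0 := if_neg (hadj i 0 hi).ne
    rw [pole, h0, Nat.cast_zero, zero_add] at hl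
    exact lt_of_lt_of_le (by exact_mod_cast Nat.lt_succ_self h) hl
  refine ⟨le_antisymm ?_ ?_, far 1 (by decide), far 2 (by decide)⟩
  · simpa only [Nat.sub_add_cancel hh] using mastAttach_edist_le G h u (h - 1) (by omega)
  · have hl := lower (u 0)
    have h1 : mastPotential h (u 0) (Sum.inl (u 0)) = 1 := if_pos rfl
    rw [pole, h1, add_comm h 1, Nat.cast_add] at hl
    exact (ENat.add_le_add_iff_left (by simp)).mp hl
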